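/- Let U be a normal ultrafilter on a measurable cardinal δ. If 2^δ = δ⁺ holds and λ is a limit ordinal with cof(λ) = δ⁺, then there is an unbounded subset of λ that is fresh over Ult(V,U). -/

import Mathlib

noncomputable section

open Cardinal Set

namespace MU

/-- The type of ordinals below the initial ordinal of `δ`, serving as the underlying
set of the cardinal `δ` and indexing the ultrapower. -/
abbrev Idx (δ : Cardinal.{0}) : Type 1 := {o : Ordinal.{0} // o < δ.ord}

/-- A filter `F` is `κ`-complete (equivalently, `<κ`-closed): it is closed under
intersections of fewer than `κ` of its members. -/
def IsCComplete (κ : Cardinal.{0}) {X : Type*} (F : Filter X) : Prop :=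
  ∀ (ι : Type) (t : ι → Set X), #ι < κ → (∀ j, t j ∈ F) → (⋂ j, t j) ∈ F

/-- `U` is a normal ultrafilter on the measurable cardinal `δ`: `δ` is uncountable and
`U` is a `δ`-complete nonprincipal ultrafilter on `δ` such that every function that is
regressive on a set in `U` is constant on a set in `U`. -/
structure IsNormalUltrafilter (δ : Cardinal.{0}) (U : Ultrafilter (Idx δ)) : Prop where
  uncountable : ℵ₀ < δ
  complete : IsCComplete δ (U : Filter (Idx δ))
  nonprincipal : ∀ i : Idx δ, ({i} : Set (Idx δ)) ∉ U
  normal : ∀ f : Idx δ → Ordinal.{0}, { i : Idx δ | f i < i.1 } ∈ U →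
    ∃ c : Ordinal.{0}, { i : Idx δ | f i = c } ∈ U

variable {δ : Cardinal.{0}} {U : Ultrafilter (Idx δ)}

/-- The Łoś ordering on representatives of ordinals of the ultrapower `Ult(V,U)`. -/
def ultLT (U : Ultrafilter (Idx δ)) (f g : Idx δ → Ordinal.{0}) : Prop :=
  { i : Idx δ | f i < g i } ∈ U

theorem ultLT_wf (hU : IsNormalUltrafilter δ U) : WellFounded (ultLT U) := by
  haveI : IsIrrefl (Idx δ → Ordinal.{0}) (ultLT U) := by
    constructor
    intro f hf
    have h : ({ i : Idx δ | f i < f i } : Set (Idx δ)) = ∅ := by ext i; simp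
    rw [ultLT, h] at hf
    exact Filter.empty_notMem (U : Filter (Idx δ)) hf
  haveI : IsTrans (Idx δ → Ordinal.{0}) (ultLT U) := by
    constructor
    intro f g h hfg hgh
    have hsub : ({ i : Idx δ | f i < g i } ∩ { i : Idx δ | g i < h i } : Set (Idx δ)) ⊆
        { i : Idx δ | f i < h i } := fun i hi => show f i < h i from lt_trans hi.1 hi.2
    exact Filter.mem_of_superset (Filter.inter_mem hfg hgh) hsub
  haveI : IsStrictOrder (Idx δ → Ordinal.{0}) (ultLT U) := ⟨⟩
  rw [RelEmbedding.wellFounded_iff_isEmpty]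
  constructor
  intro g
  have hmem : ∀ n : ℕ, { i : Idx δ | g (n + 1) i < g n i } ∈ U :=
    fun n => g.map_rel_iff.2 (Nat.lt_succ_self n)
  have hint : (⋂ n : ℕ, { i : Idx δ | g (n + 1) i < g n i }) ∈ U := by
    refine hU.complete ℕ _ ?_ hmem
    rw [Cardinal.mk_nat]
    exact hU.uncountable
  obtain ⟨i, hi⟩ := Ultrafilter.nonempty_of_mem hint
  have hdesc : ∀ n : ℕ, (fun n => g n i) (n + 1) < (fun n => g n i) n :=
    fun n => Set.mem_iInter.1 hi n
  exact (RelEmbedding.wellFounded_iff_isEmpty.1 Ordinal.lt_wf).false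
    (RelEmbedding.natGT (fun n => g n i) hdesc)

/-- The ordinal represented by `f` in the transitive collapse of the ultrapower
`Ult(V,U)`, i.e. the rank of `f` in the (well-founded) Łoś ordering. -/
def ordRank (hU : IsNormalUltrafilter δ U) (f : Idx δ → Ordinal.{0}) : Ordinal.{0} :=
  sInf { o : Ordinal.{0} | Ordinal.lift.{1} o = ((ultLT_wf hU).apply f).rank }

/-- The image of an ordinal under the ultrapower embedding `j_U : V → Ult(V,U)`. -/
def jU (hU : IsNormalUltrafilter δ U) (o : Ordinal.{0}) : Ordinal.{0} :=
  ordRank hU fun _ => o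

/-- The set of ordinals that is the transitive collapse of the element of the
ultrapower `Ult(V,U)` represented by the function `f`. -/
def ultSet (hU : IsNormalUltrafilter δ U) (f : Idx δ → Set Ordinal.{0}) :
    Set Ordinal.{0} :=
  { o : Ordinal.{0} |
    ∃ g : Idx δ → Ordinal.{0}, { i : Idx δ | g i ∈ f i } ∈ U ∧ ordRank hU g = o }

/-- A set of ordinals is (the transitive collapse of) an element of the ultrapower
`Ult(V,U)`. -/
def InUlt (hU : IsNormalUltrafilter δ U) (A : Set Ordinal.{0}) : Prop :=
  ∃ f : Idx δ → Set Ordinal.{0}, (∀ i, BddAbove (f i)) ∧ A = ultSet hU f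

/-- The least upper bound of a set of ordinals. -/
def lub (A : Set Ordinal.{0}) : Ordinal.{0} :=
  sSup ((fun o => o + 1) '' A)

/-- Hamkins: a set `A` of ordinals is fresh over `Ult(V,U)` if `A ∉ Ult(V,U)` but
`A ∩ α ∈ Ult(V,U)` for every `α < lub A`. -/
def Fresh (hU : IsNormalUltrafilter δ U) (A : Set Ordinal.{0}) : Prop :=
  ¬ InUlt hU A ∧ ∀ α < lub A, InUlt hU (A ∩ Iio α)

/-- `A` is an unbounded subset of the ordinal `l`. -/
def UnbSub (A : Set Ordinal.{0}) (l : Ordinal.{0}) : Prop :=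
  A ⊆ Iio l ∧ ∀ b < l, ∃ a ∈ A, b ≤ a

/-- `A` is a closed subset of the ordinal `l`: it contains the suprema of all of its
nonempty subsets that are bounded below `l`. -/
def ClosedIn (A : Set Ordinal.{0}) (l : Ordinal.{0}) : Prop :=
  ∀ S ⊆ A, S.Nonempty → sSup S < l → sSup S ∈ A

/-- The set of limit points of a set of ordinals. -/
def limitPts (A : Set Ordinal.{0}) : Set Ordinal.{0} :=
  { b : Ordinal.{0} | (A ∩ Iio b).Nonempty ∧ sSup (A ∩ Iio b) = b }

/-- `S` is a stationary subset of the ordinal `l`. -/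
def StationaryIn (S : Set Ordinal.{0}) (l : Ordinal.{0}) : Prop :=
  S ⊆ Iio l ∧ ∀ D : Set Ordinal.{0}, ClosedIn D l → UnbSub D l → (S ∩ D).Nonempty

/-- The order type of the set of ordinals `C` is at most `o`. -/
def otpLE (C : Set Ordinal.{0}) (o : Ordinal.{0}) : Prop :=
  ∃ g : Ordinal.{0} → Ordinal.{0}, (∀ a ∈ C, g a < o) ∧
    ∀ a ∈ C, ∀ b ∈ C, a < b → g a < g b

/-- The order type of the set of ordinals `C` is (strictly) less than `o`. -/
def otpLT (C : Set Ordinal.{0}) (o : Ordinal.{0}) : Prop :=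
  ∃ o' < o, otpLE C o'

/-- `C` is a `□(Θ)`-sequence, where `Θ` is (the initial ordinal of) an uncountable
regular cardinal. -/
structure IsSquareSeq (Θ : Ordinal.{0}) (C : Ordinal.{0} → Set Ordinal.{0}) : Prop where
  closed : ∀ γ < Θ, Order.IsSuccLimit γ → ClosedIn (C γ) γ
  unbounded : ∀ γ < Θ, Order.IsSuccLimit γ → UnbSub (C γ) γ
  coherent : ∀ γ < Θ, Order.IsSuccLimit γ → ∀ β ∈ limitPts (C γ), β < γ → C β = C γ ∩ Iio β
  nontrivial : ¬ ∃ D : Set Ordinal.{0}, ClosedIn D Θ ∧ UnbSub D Θ ∧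
    ∀ γ ∈ limitPts D, γ < Θ → D ∩ Iio γ = C γ

/-- `C` is a `□_κ`-sequence: a `□(κ⁺)`-sequence all of whose clubs have order type
at most `κ`. -/
def IsSquareKappaSeq (κ : Cardinal.{0}) (C : Ordinal.{0} → Set Ordinal.{0}) : Prop :=
  IsSquareSeq (Order.succ κ).ord C ∧
    ∀ γ < (Order.succ κ).ord, Order.IsSuccLimit γ → otpLE (C γ) κ.ord

/-- `κ` is a weakly compact cardinal: `κ` is uncountable and every coloring of the
pairs of ordinals below `κ` in fewer than `κ` colors has a homogeneous set of size `κ`. -/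
def IsWeaklyCompact (κ : Cardinal.{0}) : Prop :=
  ℵ₀ < κ ∧ ∀ (ν : Type) (c : Ordinal.{0} → Ordinal.{0} → ν), #ν < κ →
    ∃ H : Set Ordinal.{0}, H ⊆ Iio κ.ord ∧ Cardinal.lift.{1} κ ≤ #H ∧
      ∀ a ∈ H, ∀ b ∈ H, ∀ a' ∈ H, ∀ b' ∈ H, a < b → a' < b' → c a b = c a' b'

/-- `κ` is a strongly compact cardinal: every `κ`-complete filter (on any set)
extends to a `κ`-complete ultrafilter. -/
def IsStronglyCompact (κ : Cardinal.{0}) : Prop :=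
  ∀ (X : Type) (F : Filter X), IsCComplete κ F →
    ∃ G : Ultrafilter X, F ≤ (G : Filter X) ∧ IsCComplete κ (G : Filter X)

/-- `κ` is a singular cardinal. -/
def IsSingular (κ : Cardinal.{0}) : Prop :=
  ℵ₀ ≤ κ ∧ κ.ord.cof < κ

/-- The cofinality of the ordinal `l` as computed inside the ultrapower `Ult(V,U)`
(as an ordinal, i.e. the image of the ultrapower's cofinality under the transitive
collapse). -/
def cofUlt (hU : IsNormalUltrafilter δ U) (l : Ordinal.{0}) : Ordinal.{0} :=
  sInf { c : Ordinal.{0} | ∃ f : Idx δ → Ordinal.{0},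
    ordRank hU f = l ∧ ordRank hU (fun i => ((f i).cof).ord) = c }

/-- The ordinal `o` is (the transitive collapse of) a cardinal of the ultrapower
`Ult(V,U)`. -/
def CardInUlt (hU : IsNormalUltrafilter δ U) (o : Ordinal.{0}) : Prop :=
  ∃ f : Idx δ → Ordinal.{0}, ordRank hU f = o ∧
    { i : Idx δ | ((f i).card).ord = f i } ∈ U

/-- The ordinal `o` is (the transitive collapse of) a regular cardinal of the
ultrapower `Ult(V,U)`. -/
def RegularInUlt (hU : IsNormalUltrafilter δ U) (o : Ordinal.{0}) : Prop :=
  ∃ f : Idx δ → Ordinal.{0}, ordRank hU f = o ∧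
    { i : Idx δ | ((f i).card).IsRegular ∧ ((f i).card).ord = f i } ∈ U

/-- The cardinal successor of the ordinal `o` as computed inside the ultrapower
`Ult(V,U)`: the least ordinal above `o` that is a cardinal in `Ult(V,U)`. -/
def succInUlt (hU : IsNormalUltrafilter δ U) (o : Ordinal.{0}) : Ordinal.{0} :=
  sInf { c : Ordinal.{0} | o < c ∧ CardInUlt hU c }

/-- The cardinality of a set of ordinals, as an (initial) ordinal: the least ordinal
`o` such that `s` is the image of a function defined on the ordinals below `o`. -/
def setCardOrd (s : Set Ordinal.{0}) : Ordinal.{0} :=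
  sInf { o : Ordinal.{0} | ∃ g : Ordinal.{0} → Ordinal.{0}, s ⊆ g '' Iio o }

theorem IsNormalUltrafilter.iInter_mem (hU : IsNormalUltrafilter δ U) {ι : Type 1}
    (hι : #ι < lift.{1} δ) {t : ι → Set (Idx δ)} (ht : ∀ j, t j ∈ U) : (⋂ j, t j) ∈ U := by
  obtain ⟨c, hc, hcι⟩ := Cardinal.lt_lift_iff.1 hι
  have hmk : #(ULift.{1} c.out) = #ι := by simpa using hcι
  obtain ⟨e⟩ := Cardinal.eq.1 hmk
  have h := hU.complete c.out (fun a => t (e ⟨a⟩)) (by simpa using hc) fun _ => ht _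
  refine Filter.mem_of_superset h fun i hi => mem_iInter.2 fun j => ?_
  have h' := mem_iInter.1 hi (e.symm j).down
  rwa [show e ⟨(e.symm j).down⟩ = j from e.apply_symm_apply j] at h'

theorem mk_Iio_lt_lift {a : Ordinal.{0}} (ha : a < δ.ord) : #(Iio a) < lift.{1} δ := by
  rw [Cardinal.mk_Iio_ordinal, Cardinal.lift_lt]
  exact Cardinal.lt_ord.1 ha

theorem mk_Idx : #(Idx δ) = lift.{1} δ := by
  exact (Cardinal.mk_Iio_ordinal δ.ord).trans (by rw [Cardinal.card_ord])

instance : Small.{0} (Idx δ) := Ordinal.small_Iio δ.ord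

theorem IsNormalUltrafilter.tail_mem (hU : IsNormalUltrafilter δ U) (a : Idx δ) :
    {i : Idx δ | a < i} ∈ U := by
  have hlim : Order.IsSuccLimit δ.ord := Cardinal.isSuccLimit_ord hU.uncountable.le
  have hlt : Order.succ a.1 < δ.ord := hlim.succ_lt a.2
  have h := hU.iInter_mem (ι := Iio (Order.succ a.1)) (mk_Iio_lt_lift hlt)
    (t := fun b => {(⟨b.1, b.2.trans hlt⟩ : Idx δ)}ᶜ)
    fun b => Ultrafilter.compl_mem_iff_notMem.2 (hU.nonprincipal _)
  refine Filter.mem_of_superset h fun i hi => ?_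
  by_contra hai
  exact mem_iInter.1 hi ⟨i.1, mem_Iio.2 (Order.lt_succ_iff.2 (not_lt.1 hai))⟩ rfl

theorem IsNormalUltrafilter.two_power_lt (hU : IsNormalUltrafilter δ U) {c : Cardinal.{0}}
    (hc : c < δ) : (2 : Cardinal.{0}) ^ c < δ := by
  by_contra! hle
  have hle' : #(Idx δ) ≤ #(Set (ULift.{1} c.out)) := by
    rw [mk_Idx]
    simpa using Cardinal.lift_le.{1}.2 hle
  obtain ⟨F⟩ := Cardinal.le_def _ _ |>.1 hle'
  have h : ∀ a : ULift.{1} c.out, ∃ b : Prop, {i : Idx δ | (a ∈ F i) = b} ∈ U := by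
    intro a
    rcases U.mem_or_compl_mem {i | a ∈ F i} with h | h
    · exact ⟨True, by simpa using h⟩
    · exact ⟨False, by simpa [compl_ofPred] using h⟩
  choose b hb using h
  have hint := hU.iInter_mem (by simpa using hc) hb
  obtain ⟨i, hi⟩ := U.nonempty_of_mem hint
  refine hU.nonprincipal i (Filter.mem_of_superset hint fun k hk => F.injective ?_)
  ext a
  exact ((mem_iInter.1 hk a).trans (mem_iInter.1 hi a).symm).to_iff

theorem acc_rank_congr {α : Type*} {r : α → α → Prop} {a b : α} (ha : Acc r a) (hb : Acc r b)
    (h : ∀ c, r c a ↔ r c b) : ha.rank = hb.rank := by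
  rw [ha.rank_eq, hb.rank_eq]
  apply le_antisymm
  · exact Ordinal.iSup_le fun c =>
      Ordinal.le_iSup (fun c : {c // r c b} => Order.succ (hb.inv c.2).rank) ⟨c.1, (h _).1 c.2⟩
  · exact Ordinal.iSup_le fun c =>
      Ordinal.le_iSup (fun c : {c // r c a} => Order.succ (ha.inv c.2).rank) ⟨c.1, (h _).2 c.2⟩

theorem rank_congr (hU : IsNormalUltrafilter δ U) {f g : Idx δ → Ordinal.{0}}
    (h : {i | f i = g i} ∈ U) :
    ((ultLT_wf hU).apply f).rank = ((ultLT_wf hU).apply g).rank := by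
  refine acc_rank_congr _ _ fun c => ⟨fun hc => ?_, fun hc => ?_⟩
  · filter_upwards [h, hc] with i h₁ h₂ using h₁ ▸ h₂
  · filter_upwards [h, hc] with i h₁ h₂ using h₁.symm ▸ h₂

theorem rank_mem_range_lift (hU : IsNormalUltrafilter δ U) (f : Idx δ → Ordinal.{0}) :
    ∃ o : Ordinal.{0}, Ordinal.lift.{1} o = ((ultLT_wf hU).apply f).rank := by
  induction f using (ultLT_wf hU).induction with
  | _ f ih =>
    choose! R hR using ih
    let S : Set Ordinal.{0} := range fun g : (∀ i, Iio (f i + 1)) => R fun i => (g i).1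
    obtain ⟨b, hb⟩ : BddAbove S := Ordinal.bddAbove_of_small
    suffices h : ((ultLT_wf hU).apply f).rank ≤ Ordinal.lift.{1} (b + 1) from
      Ordinal.mem_range_lift_of_le h
    rw [Acc.rank_eq]
    refine Ordinal.iSup_le fun g => ?_
    let g' : Idx δ → Ordinal.{0} := fun i => min (g.1 i) (f i)
    have hgg' : {i | g' i = g.1 i} ∈ U := by
      filter_upwards [g.2] with i hi using min_eq_left hi.le
    have hg' : ultLT U g' f := by
      filter_upwards [hgg', g.2] with i h₁ h₂ using h₁ ▸ h₂
    rw [← rank_congr hU hgg', ← hR _ hg', Order.succ_le_iff, Ordinal.lift_lt, Order.lt_add_one_iff]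
    exact hb ⟨fun i => ⟨g' i, mem_Iio.2 (Order.lt_add_one_iff.2 (min_le_right _ _))⟩, rfl⟩

theorem lift_ordRank (hU : IsNormalUltrafilter δ U) (f : Idx δ → Ordinal.{0}) :
    Ordinal.lift.{1} (ordRank hU f) = ((ultLT_wf hU).apply f).rank :=
  csInf_mem (rank_mem_range_lift hU f)

theorem ordRank_congr (hU : IsNormalUltrafilter δ U) {f g : Idx δ → Ordinal.{0}}
    (h : {i | f i = g i} ∈ U) : ordRank hU f = ordRank hU g := by
  rw [← Ordinal.lift_inj.{1}, lift_ordRank, lift_ordRank, rank_congr hU h]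

theorem ordRank_lt_of_ultLT (hU : IsNormalUltrafilter δ U) {f g : Idx δ → Ordinal.{0}}
    (h : ultLT U f g) : ordRank hU f < ordRank hU g := by
  rw [← Ordinal.lift_lt.{1}, lift_ordRank, lift_ordRank]
  exact Acc.rank_lt_of_rel _ h

theorem ordRank_eq_iff (hU : IsNormalUltrafilter δ U) {f g : Idx δ → Ordinal.{0}} :
    ordRank hU f = ordRank hU g ↔ {i | f i = g i} ∈ U := by
  refine ⟨fun h => ?_, ordRank_congr hU⟩
  have hfg : {i | f i < g i} ∉ U := fun h' => (ordRank_lt_of_ultLT hU h').ne h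
  have hgf : {i | g i < f i} ∉ U := fun h' => (ordRank_lt_of_ultLT hU h').ne' h
  filter_upwards [Ultrafilter.compl_mem_iff_notMem.2 hfg,
    Ultrafilter.compl_mem_iff_notMem.2 hgf] with i h₁ h₂
  exact le_antisymm (not_lt.1 h₂) (not_lt.1 h₁)

theorem ordRank_surjective (hU : IsNormalUltrafilter δ U) : Function.Surjective (ordRank hU) := by
  intro o
  have hmono : StrictMono (jU hU) := fun a b hab =>
    ordRank_lt_of_ultLT hU (Filter.mem_of_superset Filter.univ_mem fun _ _ => hab)
  have hle : Ordinal.lift.{1} o ≤ ((ultLT_wf hU).apply fun _ => o).rank := by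
    rw [← lift_ordRank hU, Ordinal.lift_le]
    exact hmono.le_apply
  obtain ⟨g, hg, hgo⟩ := Acc.mem_range_rank_of_le _ hle
  exact ⟨g, Ordinal.lift_inj.1 ((lift_ordRank hU g).trans hgo)⟩

theorem ordRank_mem_ultSet (hU : IsNormalUltrafilter δ U) {f : Idx δ → Set Ordinal.{0}}
    {g : Idx δ → Ordinal.{0}} : ordRank hU g ∈ ultSet hU f ↔ {i | g i ∈ f i} ∈ U := by
  refine ⟨fun ⟨h, hh, hhg⟩ => ?_, fun h => ⟨g, h, rfl⟩⟩
  filter_upwards [hh, (ordRank_eq_iff hU).1 hhg] with i h₁ h₂ using h₂ ▸ h₁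

theorem ultSet_diff (hU : IsNormalUltrafilter δ U) (f g : Idx δ → Set Ordinal.{0}) :
    ultSet hU (fun i => f i \ g i) = ultSet hU f \ ultSet hU g := by
  ext o
  obtain ⟨h, rfl⟩ := ordRank_surjective hU o
  simp only [mem_sdiff, ordRank_mem_ultSet, ← Ultrafilter.compl_mem_iff_notMem]
  exact Filter.inter_mem_iff

theorem InUlt.diff {hU : IsNormalUltrafilter δ U} {A B : Set Ordinal.{0}} (hA : InUlt hU A)
    (hB : InUlt hU B) : InUlt hU (A \ B) := by
  obtain ⟨f, hf, rfl⟩ := hA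
  obtain ⟨g, -, rfl⟩ := hB
  exact ⟨fun i => f i \ g i, fun i => (hf i).mono sdiff_subset, (ultSet_diff hU f g).symm⟩

/-- The ultrapower contains every set of at most `δ` ordinals. -/
theorem InUlt.of_mk_le (hU : IsNormalUltrafilter δ U) {S : Set Ordinal.{0}}
    (hS : #S ≤ lift.{1} δ) : InUlt hU S := by
  rw [← mk_Idx] at hS
  obtain ⟨e⟩ := Cardinal.le_def _ _ |>.1 hS
  have : Small.{0} S := small_of_injective e.injective
  choose r hr using ordRank_surjective hU
  refine ⟨fun i => {x | ∃ s : S, e s < i ∧ r s.1 i = x}, fun i => ?_, ?_⟩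
  · have hsub : {x | ∃ s : S, e s < i ∧ r s.1 i = x} ⊆ range fun s : S => r s.1 i := by
      rintro x ⟨s, -, rfl⟩
      exact ⟨s, rfl⟩
    exact (Ordinal.bddAbove_of_small (s := range fun s : S => r s.1 i)).mono hsub
  · ext o
    constructor
    · intro ho
      rw [← hr o, ordRank_mem_ultSet]
      filter_upwards [hU.tail_mem (e ⟨o, ho⟩)] with i hi using ⟨⟨o, ho⟩, hi, rfl⟩
    · rintro ⟨g, hg, rfl⟩
      obtain ⟨i₀, s₀, -⟩ := U.nonempty_of_mem hg
      have : Nonempty S := ⟨s₀⟩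
      choose! k hk hkg using show ∀ i, g i ∈ {x | ∃ s : S, e s < i ∧ r s.1 i = x} →
        ∃ s : S, e s < i ∧ r s.1 i = g i from fun _ h => h
      obtain ⟨c, hc⟩ := hU.normal (fun i => (e (k i)).1) <| by
        filter_upwards [hg] with i hi using hk i hi
      have hgc := Filter.inter_mem hg hc
      obtain ⟨i₁, -, hi₁⟩ := U.nonempty_of_mem hgc
      suffices h : ordRank hU g = k i₁ by
        rw [h]
        exact (k i₁).2
      rw [← hr (k i₁), ordRank_eq_iff]
      filter_upwards [hgc] with i hi
      have hki : k i = k i₁ := e.injective (Subtype.ext (hi.2.trans hi₁.symm))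
      rw [← hki, hkg i hi.1]

theorem exists_orderEmbedding_of_le_mk {s : Set Ordinal.{0}} (hs : lift.{1} δ ≤ #s) :
    Nonempty (Idx δ ↪o s) := by
  have h : Ordinal.type (α := Idx δ) (· < ·) ≤ Ordinal.type (α := s) (· < ·) := by
    have hδ : Ordinal.type (α := Idx δ) (· < ·) = (lift.{1} δ).ord :=
      (Ordinal.type_lt_Iio δ.ord).trans (Cardinal.lift_ord δ)
    rw [hδ]
    exact (Cardinal.ord_le_ord.2 hs).trans (Cardinal.ord_le_type _)
  obtain ⟨e⟩ := Ordinal.type_le_iff'.1 h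
  exact ⟨OrderEmbedding.ofStrictMono e fun a b => e.map_rel_iff.2⟩

/-- If every proper initial segment of a set of the ultrapower has at most `δ` elements, then
its cardinality in the ultrapower is below `j(δ)`. -/
theorem mk_lt_of_forall_mk_inter_Iio_le (hU : IsNormalUltrafilter δ U)
    {f : Idx δ → Set Ordinal.{0}}
    (hf : ∀ b ∈ ultSet hU f, #(ultSet hU f ∩ Iio b : Set Ordinal.{0}) ≤ lift.{1} δ) :
    {i | #(f i) < lift.{1} δ} ∈ U := by
  by_contra hW
  have hV : {i | lift.{1} δ ≤ #(f i)} ∈ U := by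
    filter_upwards [Ultrafilter.compl_mem_iff_notMem.2 hW] with i hi using not_lt.1 hi
  have hφ : ∀ i : Idx δ, ∃ h : Idx δ, Nonempty (Set (Iio i.1) ↪ Iio h) := by
    intro i
    have hlt : (2 : Cardinal.{0}) ^ i.1.card < δ := hU.two_power_lt (Cardinal.lt_ord.1 i.2)
    have hmk : #(Set (Iio i.1)) = #(Iio ((2 : Cardinal.{0}) ^ i.1.card).ord) := by
      simp [Cardinal.mk_Iio_ordinal]
    obtain ⟨p⟩ := Cardinal.eq.1 hmk
    refine ⟨⟨_, Cardinal.ord_lt_ord.2 hlt⟩,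
      ⟨fun x => ⟨⟨(p x).1, (mem_Iio.1 (p x).2).trans (Cardinal.ord_lt_ord.2 hlt)⟩,
        mem_Iio.2 (mem_Iio.1 (p x).2)⟩, fun x y hxy => ?_⟩⟩
    exact p.injective (Subtype.ext (congrArg (fun z => z.1.1) hxy))
  choose h φ using hφ
  replace φ := fun i => (φ i).some
  have he : ∀ i, ∃ e : Idx δ → Ordinal.{0}, i ∈ {i | lift.{1} δ ≤ #(f i)} →
      StrictMono e ∧ ∀ a, e a ∈ f i := by
    intro i
    by_cases hi : lift.{1} δ ≤ #(f i)
    · obtain ⟨e⟩ := exists_orderEmbedding_of_le_mk hi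
      exact ⟨fun a => e a, fun _ => ⟨fun a b hab => e.strictMono hab, fun a => (e a).2⟩⟩
    · exact ⟨fun _ => 0, fun h => absurd h hi⟩
  choose e he using he
  let T : Set (Idx δ) → ∀ i : Idx δ, Set (Iio i.1) :=
    fun X i => {a | ∃ x ∈ X, x.1 = a.1}
  let G : Set (Idx δ) → Idx δ → Ordinal.{0} := fun X i => e i (φ i (T X i))
  have hmem : ∀ k : Idx δ → Idx δ, ordRank hU (fun i => e i (k i)) ∈ ultSet hU f := by
    intro k
    rw [ordRank_mem_ultSet]
    filter_upwards [hV] with i hi using (he i hi).2 _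
  have hG : ∀ X, ordRank hU (G X) ∈ ultSet hU f ∩ Iio (ordRank hU fun i => e i (h i)) := by
    refine fun X => ⟨hmem _, mem_Iio.2 (ordRank_lt_of_ultLT hU ?_)⟩
    filter_upwards [hV] with i hi using (he i hi).1 (mem_Iio.1 (φ i (T X i)).2)
  have hinj : ∀ X Y, ordRank hU (G X) = ordRank hU (G Y) → X ⊆ Y := by
    intro X Y hXY x hx
    obtain ⟨i, ⟨hi, hxi⟩, hiV⟩ := U.nonempty_of_mem
      (Filter.inter_mem (Filter.inter_mem ((ordRank_eq_iff hU).1 hXY) (hU.tail_mem x)) hV)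
    have hT : T X i = T Y i :=
      (φ i).injective (Subtype.ext ((he i hiV).1.injective hi))
    have hxT : (⟨x.1, mem_Iio.2 hxi⟩ : Iio i.1) ∈ T Y i := hT ▸ ⟨x, hx, rfl⟩
    obtain ⟨y, hy, hyx⟩ := hxT
    exact Subtype.ext hyx ▸ hy
  have hle := (Cardinal.mk_le_of_injective (f := fun X => (⟨_, hG X⟩ : ↑(ultSet hU f ∩ Iio _)))
    fun X Y hXY => (hinj X Y (congrArg Subtype.val hXY)).antisymm
      (hinj Y X (congrArg Subtype.val hXY).symm)).trans (hf _ (hmem h))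
  rw [Cardinal.mk_set, mk_Idx] at hle
  exact (Cardinal.cantor _).not_ge hle

theorem ultSet_congr (hU : IsNormalUltrafilter δ U) {f g : Idx δ → Set Ordinal.{0}}
    (h : {i | f i = g i} ∈ U) : ultSet hU f = ultSet hU g := by
  ext o
  obtain ⟨k, rfl⟩ := ordRank_surjective hU o
  rw [ordRank_mem_ultSet, ordRank_mem_ultSet]
  refine Filter.congr_sets ?_
  filter_upwards [h] with i hi
  rw [show f i = g i from hi]

/-- A set of the ultrapower whose cardinality there is below `j(δ)` has at most `2 ^ δ` subsets
in the ultrapower. -/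
theorem mk_setOf_inUlt_subset_le (hU : IsNormalUltrafilter δ U) {f : Idx δ → Set Ordinal.{0}}
    (hf : {i | #(f i) < lift.{1} δ} ∈ U) :
    #{X : Set Ordinal.{0} | InUlt hU X ∧ X ⊆ ultSet hU f} ≤ lift.{1} (2 ^ δ) := by
  have hψ : ∀ i, ∃ ψ : Idx δ → Set Ordinal.{0}, #(f i) < lift.{1} δ →
      ∀ X ⊆ f i, ∃ a, ψ a = X := by
    intro i
    by_cases hi : #(f i) < lift.{1} δ
    · have hle : #(Set (f i)) ≤ #(Idx δ) := by
        obtain ⟨c, hc, hci⟩ := Cardinal.lt_lift_iff.1 hi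
        rw [mk_Idx, Cardinal.mk_set, ← hci]
        simpa using Cardinal.lift_le.{1}.2 (hU.two_power_lt hc).le
      obtain ⟨p⟩ := Cardinal.le_def _ _ |>.1 hle
      refine ⟨fun a => Subtype.val '' Function.invFun p a,
        fun _ X hX => ⟨p (Subtype.val ⁻¹' X), ?_⟩⟩
      change Subtype.val '' Function.invFun p (p _) = X
      rw [Function.leftInverse_invFun p.injective, Subtype.image_preimage_coe, inter_eq_right.2 hX]
    · exact ⟨fun _ => ∅, fun h => absurd h hi⟩
  choose ψ hψ using hψ
  have hsub : {X : Set Ordinal.{0} | InUlt hU X ∧ X ⊆ ultSet hU f} ⊆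
      range fun k : Idx δ → Idx δ => ultSet hU fun i => ψ i (k i) := by
    rintro X ⟨⟨g, -, rfl⟩, hX⟩
    have hk : ∀ i, ∃ a, #(f i) < lift.{1} δ → ψ i a = f i \ (f i \ g i) := by
      intro i
      by_cases hi : #(f i) < lift.{1} δ
      · obtain ⟨a, ha⟩ := hψ i hi _ sdiff_subset
        exact ⟨a, fun _ => ha⟩
      · exact ⟨i, fun h => absurd h hi⟩
    choose k hk using hk
    refine ⟨k, ?_⟩
    have hcongr : {i | ψ i (k i) = f i \ (f i \ g i)} ∈ U := by
      filter_upwards [hf] with i hi using hk i hi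
    change ultSet hU (fun i => ψ i (k i)) = _
    rw [ultSet_congr hU hcongr, ultSet_diff, ultSet_diff, sdiff_sdiff_cancel_left hX]
  calc _ ≤ #(Idx δ → Idx δ) := (Cardinal.mk_le_mk_of_subset hsub).trans Cardinal.mk_range_le
    _ = lift.{1} δ ^ lift.{1} δ := by rw [← Cardinal.power_def, mk_Idx]
    _ = lift.{1} (2 ^ δ) := by
      rw [← Cardinal.lift_power, Cardinal.power_self_eq hU.uncountable.le]

theorem lub_le_of_subset_Iio {A : Set Ordinal.{0}} {l : Ordinal.{0}} (h : A ⊆ Iio l) :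
    lub A ≤ l :=
  csSup_le' (forall_mem_image.2 fun _ ha => Order.add_one_le_of_lt (mem_Iio.1 (h ha)))

theorem UnbSub.or_diff {C X : Set Ordinal.{0}} {l : Ordinal.{0}} (hC : UnbSub C l)
    (hX : X ⊆ C) : UnbSub X l ∨ UnbSub (C \ X) l := by
  by_cases h : ∀ b < l, ∃ a ∈ X, b ≤ a
  · exact Or.inl ⟨hX.trans hC.1, h⟩
  · push Not at h
    obtain ⟨b, hb, hbX⟩ := h
    refine Or.inr ⟨sdiff_subset.trans hC.1, fun c hc => ?_⟩
    obtain ⟨a, ha, hca⟩ := hC.2 (max b c) (max_lt hb hc)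
    exact ⟨a, ⟨ha, fun haX => (hbX a haX).not_ge ((le_max_left _ _).trans hca)⟩,
      (le_max_right _ _).trans hca⟩

/-- An ordinal has an unbounded subset whose cardinality is its cofinality and whose proper
initial segments are smaller. -/
theorem exists_unbSub_mk_inter_Iio_lt (l : Ordinal.{0}) :
    ∃ C : Set Ordinal.{0}, UnbSub C l ∧ #C = lift.{1} l.cof ∧
      ∀ a < l, #(C ∩ Iio a : Set Ordinal.{0}) < lift.{1} l.cof := by
  obtain ⟨s, hs, hst⟩ := Ordinal.exists_ord_cof_eq (Iio l)
  rw [Ordinal.cof_Iio, ← Ordinal.lift_cof] at hst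
  have hmk : #s = lift.{1} l.cof := by simpa using congrArg Ordinal.card hst
  refine ⟨Subtype.val '' s, ⟨?_, fun b hb => ?_⟩, ?_, fun a ha => ?_⟩
  · rintro _ ⟨x, -, rfl⟩
    exact x.2
  · obtain ⟨x, hx, hbx⟩ := hs ⟨b, hb⟩
    exact ⟨x, ⟨x, hx, rfl⟩, hbx⟩
  · rw [Cardinal.mk_image_eq Subtype.val_injective, hmk]
  · obtain ⟨x, hx, hax⟩ := hs ⟨a, ha⟩
    have hlt : #(Iio (⟨x, hx⟩ : s)) < #s := Cardinal.mk_Iio_lt _ (by rw [hmk, hst])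
    rw [← hmk]
    refine lt_of_le_of_lt ?_ hlt
    have hsub : Subtype.val '' s ∩ Iio a ⊆
        (fun y : s => (y.1.1 : Ordinal.{0})) '' Iio (⟨x, hx⟩ : s) := by
      rintro _ ⟨⟨y, hy, rfl⟩, hya⟩
      exact ⟨⟨y, hy⟩, mem_Iio.2 (show y < x from (mem_Iio.1 hya).trans_le hax), rfl⟩
    exact (Cardinal.mk_le_mk_of_subset hsub).trans Cardinal.mk_image_le

/-- If `2^δ = δ⁺` and `λ` is a limit ordinal with `cof(λ) = δ⁺`, then there is an
unbounded subset of `λ` that is fresh over `Ult(V,U)`. -/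
theorem stmt5 (δ : Cardinal.{0}) (U : Ultrafilter (Idx δ)) (hU : IsNormalUltrafilter δ U)
    (hGCH : (2 : Cardinal.{0}) ^ δ = Order.succ δ)
    (l : Ordinal.{0}) (hl : Order.IsSuccLimit l) (hcof : l.cof = Order.succ δ) :
    ∃ A : Set Ordinal.{0}, UnbSub A l ∧ Fresh hU A := by
  obtain ⟨C, hC, hmk, hseg⟩ := exists_unbSub_mk_inter_Iio_lt l
  rw [hcof] at hmk hseg
  replace hseg : ∀ a < l, #(C ∩ Iio a : Set Ordinal.{0}) ≤ lift.{1} δ := fun a ha => by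
    simpa [Cardinal.lift_succ] using hseg a ha
  by_contra! hno
  have hunb : ∀ X ⊆ C, UnbSub X l → InUlt hU X := by
    intro X hXC hX
    by_contra hXU
    exact hno X hX ⟨hXU, fun a ha => .of_mk_le hU <|
      (Cardinal.mk_le_mk_of_subset (inter_subset_inter_left _ hXC)).trans
        (hseg a (ha.trans_le (lub_le_of_subset_Iio hX.1)))⟩
  have hCU := hunb C subset_rfl hC
  have hsubsets : ∀ X ⊆ C, InUlt hU X := by
    intro X hX
    rcases hC.or_diff hX with h | h
    · exact hunb X hX h
    · rw [← sdiff_sdiff_cancel_left hX]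
      exact hCU.diff (hunb _ sdiff_subset h)
  obtain ⟨f, -, rfl⟩ := hCU
  have hle := mk_setOf_inUlt_subset_le hU
    (mk_lt_of_forall_mk_inter_Iio_le hU fun b hb => hseg b (hC.1 hb))
  have hpow : {X : Set Ordinal.{0} | InUlt hU X ∧ X ⊆ ultSet hU f} = 𝒫 ultSet hU f :=
    ext fun X => ⟨And.right, fun hX => ⟨hsubsets X hX, hX⟩⟩
  rw [hpow, Cardinal.mk_powerset, hGCH, hmk] at hle
  exact (Cardinal.cantor _).not_ge hle

end MU
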